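/- For every 0 < β < 1 and every t > 0, the Wright-type transform of the exponential function satisfies ∫_0^∞ g_β(s;t) e^s ds = E_β(t^β) = ∑_{n=0}^∞ t^{nβ} / Γ(nβ + 1), the integral being convergent. -/

import Mathlib

open MeasureTheory Real Set Filter

/-- The Wright-type density `g_β(x;t) = t^{-β} ∑_{k} (−x/t^β)^k / (k! Γ(1 − β(k+1)))`. -/
noncomputable def wrightG (β x t : ℝ) : ℝ :=
  t ^ (-β) * ∑' k : ℕ, (-x / t ^ β) ^ k / ((Nat.factorial k : ℝ) * Real.Gamma (1 - β * (k + 1)))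

/-- The two-parameter Mittag-Leffler function `E_{β,α}(z) = ∑_k z^k / Γ(βk + α)`. -/
noncomputable def mittagLeffler (β α z : ℝ) : ℝ :=
  ∑' k : ℕ, z ^ k / Real.Gamma (β * k + α)

/-- The Caputo fractional derivative of order `β ∈ (0,1)`:
`D_c^β h(t) = (1/Γ(1−β)) ∫_0^t (t−τ)^{−β} h′(τ) dτ`. -/
noncomputable def caputo (β : ℝ) (h : ℝ → ℝ) (t : ℝ) : ℝ :=
  (1 / Real.Gamma (1 - β)) * ∫ τ in (0:ℝ)..t, (t - τ) ^ (-β) * deriv h τ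

/-- A function is of exponential order on `[0,∞)` if `|h(x)| ≤ C e^{a x}` there. -/
def ExpOrder (h : ℝ → ℝ) : Prop :=
  ∃ C a : ℝ, 0 < C ∧ 0 < a ∧ ∀ x : ℝ, 0 ≤ x → |h x| ≤ C * Real.exp (a * x)


/-- The point at distance `r` from `c` on the ray that leaves `c` in the direction `e^{iφ}`. -/
noncomputable def hankelRay (φ c r : ℝ) : ℂ := c + r * Complex.exp (φ * Complex.I)

/-- The integral of `e^σ σ^p` along the ray `hankelRay φ c`, the upper half of a Hankel contour. -/
noncomputable def hankelIntegral (φ c p : ℝ) : ℂ :=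
  ∫ r in Ioi (0 : ℝ), Complex.exp (φ * Complex.I) *
    (Complex.exp (hankelRay φ c r) * hankelRay φ c r ^ (p : ℂ))

lemma integrableOn_Ioi_of_norm_le_exp {f : ℝ → ℂ} {C δ : ℝ} (hδ : δ < 0) (hf : Measurable f)
    (h : ∀ r, 0 < r → ‖f r‖ ≤ C * Real.exp (δ * r)) : IntegrableOn f (Ioi 0) := by
  refine ((integrableOn_exp_mul_Ioi hδ 0).const_mul C).mono' hf.aestronglyMeasurable ?_
  exact (ae_restrict_iff' measurableSet_Ioi).2 (.of_forall fun r hr => h r hr)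

lemma exists_rpow_le_mul_exp (p : ℝ) {δ : ℝ} (hp : 0 ≤ p) (hδ : 0 < δ) :
    ∃ C : ℝ, 0 < C ∧ ∀ u : ℝ, 0 < u → u ^ p ≤ C * Real.exp (δ * u) := by
  set ε := δ / (p + 1) with hε
  have hε0 : 0 < ε := by positivity
  have hpε : p * ε ≤ δ := by
    rw [hε, mul_div_assoc', div_le_iff₀ (by positivity)]; nlinarith
  refine ⟨Real.exp (-p * (Real.log ε + 1)), Real.exp_pos _, fun u hu => ?_⟩
  rw [Real.rpow_def_of_pos hu, ← Real.exp_add]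
  apply Real.exp_le_exp.2
  have h1 := Real.log_le_sub_one_of_pos (mul_pos hε0 hu)
  rw [Real.log_mul hε0.ne' hu.ne'] at h1
  have h2 : Real.log u * p ≤ (ε * u - 1 - Real.log ε) * p :=
    mul_le_mul_of_nonneg_right (by linarith) hp
  have h3 : p * ε * u ≤ δ * u := mul_le_mul_of_nonneg_right hpε hu.le
  nlinarith

lemma exists_rpow_le_mul_add {β ε : ℝ} (hβ0 : 0 < β) (hβ1 : β < 1) (hε : 0 < ε) :
    ∃ K : ℝ, 0 < K ∧ ∀ u : ℝ, 0 < u → u ^ β ≤ ε * u + K := by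
  set U := ε ^ (1 / (β - 1)) with hU
  have hU0 : 0 < U := Real.rpow_pos_of_pos hε _
  refine ⟨U ^ β, Real.rpow_pos_of_pos hU0 _, fun u hu => ?_⟩
  rcases le_total u U with h | h
  · have := Real.rpow_le_rpow hu.le h hβ0.le
    nlinarith [mul_pos hε hu]
  · have h1 : u ^ (β - 1) ≤ U ^ (β - 1) :=
      Real.rpow_le_rpow_of_nonpos hU0 h (by linarith)
    have h2 : U ^ (β - 1) = ε := by
      rw [hU, ← Real.rpow_mul hε.le, one_div_mul_cancel (by linarith), Real.rpow_one]
    have h3 : u ^ β = u ^ (β - 1) * u := by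
      rw [← Real.rpow_add_one hu.ne']; ring_nf
    rw [h3]
    have := Real.rpow_pos_of_pos hU0 β
    nlinarith

section HankelRay

variable {φ c r : ℝ}

lemma hankelRay_re : (hankelRay φ c r).re = c + r * Real.cos φ := by
  simp [hankelRay, Complex.exp_ofReal_mul_I_re]

lemma hankelRay_im : (hankelRay φ c r).im = r * Real.sin φ := by
  simp [hankelRay, Complex.exp_ofReal_mul_I_im]

lemma measurable_hankelRay : Measurable (hankelRay φ c) := by
  unfold hankelRay; fun_prop

lemma norm_exp_hankelRay :
    ‖Complex.exp (hankelRay φ c r)‖ = Real.exp c * Real.exp (Real.cos φ * r) := by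
  rw [Complex.norm_exp, hankelRay_re, Real.exp_add, mul_comm r]

lemma norm_hankelRay_le (hr : 0 ≤ r) : ‖hankelRay φ c r‖ ≤ |c| + r := by
  unfold hankelRay
  refine (norm_add_le _ _).trans ?_
  simp [Complex.norm_exp_ofReal_mul_I, abs_of_nonneg hr]

lemma hankelRay_mem_slitPlane (hφ : 0 < Real.sin φ) (hr : 0 < r) :
    hankelRay φ c r ∈ Complex.slitPlane := by
  rw [Complex.mem_slitPlane_iff, hankelRay_im]
  exact Or.inr (mul_pos hr hφ).ne'

lemma hankelRay_zero : hankelRay φ c 0 = c := by simp [hankelRay]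

lemma hankelRay_mul_conj_im :
    (hankelRay φ c r * Complex.exp (-(φ * Complex.I))).im = -(c * Real.sin φ) := by
  have : -((φ : ℂ) * Complex.I) = ((-φ : ℝ) : ℂ) * Complex.I := by push_cast; ring
  rw [this, Complex.mul_im, hankelRay_re, hankelRay_im, Complex.exp_ofReal_mul_I_re,
    Complex.exp_ofReal_mul_I_im, Real.cos_neg, Real.sin_neg]
  ring

lemma le_norm_hankelRay : c * Real.sin φ ≤ ‖hankelRay φ c r‖ := by
  have h := Complex.abs_im_le_norm (hankelRay φ c r * Complex.exp (-(φ * Complex.I)))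
  rw [hankelRay_mul_conj_im, norm_mul] at h
  have h2 : ‖Complex.exp (-((φ : ℂ) * Complex.I))‖ = 1 := by
    have : -((φ : ℂ) * Complex.I) = ((-φ : ℝ) : ℂ) * Complex.I := by push_cast; ring
    rw [this, Complex.norm_exp_ofReal_mul_I]
  rw [h2, mul_one, abs_neg] at h
  exact (le_abs_self _).trans h

lemma arg_hankelRay_nonneg (hφ : 0 < Real.sin φ) (hr : 0 < r) :
    0 ≤ (hankelRay φ c r).arg := by
  rw [Complex.arg_nonneg_iff, hankelRay_im]; positivity

lemma arg_hankelRay_le (hφ0 : 0 < φ) (hφ : 0 < Real.sin φ) (hc : 0 < c) :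
    (hankelRay φ c r).arg ≤ φ := by
  by_contra! h
  have h1 := hankelRay_mul_conj_im (φ := φ) (c := c) (r := r)
  have h2 : hankelRay φ c r * Complex.exp (-(φ * Complex.I)) =
      ‖hankelRay φ c r‖ * Complex.exp (((hankelRay φ c r).arg - φ : ℝ) * Complex.I) := by
    conv_lhs => rw [← Complex.norm_mul_exp_arg_mul_I (hankelRay φ c r)]
    rw [mul_assoc, ← Complex.exp_add]
    congr 2
    push_cast; ring
  rw [h2, Complex.im_ofReal_mul, Complex.exp_ofReal_mul_I_im] at h1
  have h3 : 0 ≤ Real.sin ((hankelRay φ c r).arg - φ) :=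
    Real.sin_nonneg_of_nonneg_of_le_pi (by linarith)
      (by linarith [Complex.arg_le_pi (hankelRay φ c r)])
  nlinarith [mul_nonneg (norm_nonneg (hankelRay φ c r)) h3, mul_pos hc hφ]

lemma hasDerivAt_hankelRay : HasDerivAt (hankelRay φ c) (Complex.exp (φ * Complex.I)) r := by
  have := ((Complex.ofRealCLM.hasDerivAt (x := r)).mul_const
    (Complex.exp (φ * Complex.I))).const_add (c : ℂ)
  change HasDerivAt (fun r : ℝ => (c : ℂ) + r * Complex.exp (φ * Complex.I)) _ r
  simpa using this

lemma hasDerivAt_hankelRay_left :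
    HasDerivAt (fun c => hankelRay φ c r) 1 c := by
  have := (Complex.ofRealCLM.hasDerivAt (x := c)).add_const ((r : ℂ) * Complex.exp (φ * Complex.I))
  simpa [hankelRay, Function.comp_def] using this

lemma exists_exp_mul_rpow_norm_hankelRay_le (p : ℝ) (hφ : 0 < Real.sin φ) (hφ' : Real.cos φ < 0)
    (hc : 0 < c) : ∃ C : ℝ, 0 < C ∧ ∀ r, 0 < r →
      ‖Complex.exp (hankelRay φ c r)‖ * ‖hankelRay φ c r‖ ^ p ≤
        C * Real.exp (Real.cos φ / 2 * r) := by
  have hm : 0 < c * Real.sin φ := mul_pos hc hφ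
  have key : ∃ C : ℝ, 0 < C ∧ ∀ r, 0 < r →
      ‖hankelRay φ c r‖ ^ p ≤ C * Real.exp (-Real.cos φ / 2 * r) := by
    rcases le_total 0 p with hp | hp
    · obtain ⟨C, hC, h⟩ := exists_rpow_le_mul_exp p hp (δ := -Real.cos φ / 2) (by linarith)
      refine ⟨C * Real.exp (-Real.cos φ / 2 * c), by positivity, fun r hr => ?_⟩
      refine (h _ (hm.trans_le le_norm_hankelRay)).trans ?_
      rw [mul_assoc, ← Real.exp_add]
      gcongr
      have := norm_hankelRay_le (φ := φ) (c := c) hr.le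
      rw [abs_of_pos hc] at this
      nlinarith
    · refine ⟨(c * Real.sin φ) ^ p, Real.rpow_pos_of_pos hm _, fun r hr => ?_⟩
      refine (Real.rpow_le_rpow_of_nonpos hm le_norm_hankelRay hp).trans ?_
      exact le_mul_of_one_le_right (Real.rpow_pos_of_pos hm _).le
        (Real.one_le_exp (mul_nonneg (by linarith) hr.le))
  obtain ⟨C, hC, h⟩ := key
  refine ⟨Real.exp c * C, by positivity, fun r hr => ?_⟩
  rw [norm_exp_hankelRay]
  calc _ ≤ Real.exp c * Real.exp (Real.cos φ * r) * (C * Real.exp (-Real.cos φ / 2 * r)) := by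
        gcongr; exact h r hr
    _ = Real.exp c * C * (Real.exp (Real.cos φ * r) * Real.exp (-Real.cos φ / 2 * r)) := by ring
    _ = _ := by rw [← Real.exp_add]; ring_nf

lemma measurable_exp_mul_cpow_hankelRay (p : ℂ) :
    Measurable fun r => Complex.exp (hankelRay φ c r) * hankelRay φ c r ^ p :=
  (Complex.measurable_exp.comp measurable_hankelRay).mul (measurable_hankelRay.pow_const p)

lemma integrableOn_exp_mul_cpow_hankelRay (p : ℝ) (hφ : 0 < Real.sin φ) (hφ' : Real.cos φ < 0)
    (hc : 0 < c) : IntegrableOn (fun r => Complex.exp (hankelRay φ c r) *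
      hankelRay φ c r ^ (p : ℂ)) (Ioi 0) := by
  obtain ⟨C, -, h⟩ := exists_exp_mul_rpow_norm_hankelRay_le p hφ hφ' hc
  refine integrableOn_Ioi_of_norm_le_exp (C := C) (δ := Real.cos φ / 2) (by linarith)
    (measurable_exp_mul_cpow_hankelRay _) fun r hr => ?_
  rw [norm_mul, Complex.norm_cpow_real]
  exact h r hr

lemma hasDerivAt_exp_mul_cpow {z : ℂ} (hz : z ∈ Complex.slitPlane) (p : ℝ) :
    HasDerivAt (fun z => Complex.exp z * z ^ (p : ℂ))
      (Complex.exp z * z ^ (p : ℂ) + p * (Complex.exp z * z ^ ((p - 1 : ℝ) : ℂ))) z := by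
  refine ((Complex.hasDerivAt_exp z).mul
    ((hasDerivAt_id z).cpow_const (c := (p : ℂ)) hz)).congr_deriv ?_
  simp only [id]
  push_cast
  ring

lemma tendsto_exp_mul_cpow_hankelRay {p C : ℝ} (hφ' : Real.cos φ < 0)
    (h : ∀ r, 0 < r → ‖Complex.exp (hankelRay φ c r)‖ * ‖hankelRay φ c r‖ ^ p ≤
      C * Real.exp (Real.cos φ / 2 * r)) : Tendsto (fun r => Complex.exp (hankelRay φ c r) *
      hankelRay φ c r ^ (p : ℂ)) atTop (nhds 0) := by
  have hlim : Tendsto (fun r => C * Real.exp (Real.cos φ / 2 * r)) atTop (nhds 0) := by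
    have : Tendsto (fun r => Real.cos φ / 2 * r) atTop atBot :=
      tendsto_id.const_mul_atTop_of_neg (by linarith)
    simpa using (Real.tendsto_exp_atBot.comp this).const_mul C
  refine squeeze_zero_norm' ?_ hlim
  filter_upwards [eventually_gt_atTop 0] with r hr
  rw [norm_mul, Complex.norm_cpow_real]
  exact h r hr

/-- Integration by parts along the ray. -/
lemma hankelIntegral_add_eq (p : ℝ) (hφ : 0 < Real.sin φ) (hφ' : Real.cos φ < 0) (hc : 0 < c) :
    hankelIntegral φ c p + p * hankelIntegral φ c (p - 1) = -((Real.exp c * c ^ p : ℝ) : ℂ) := by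
  have h1 := (integrableOn_exp_mul_cpow_hankelRay p hφ hφ' hc).const_mul
    (Complex.exp (φ * Complex.I))
  have h2 := ((integrableOn_exp_mul_cpow_hankelRay (p - 1) hφ hφ' hc).const_mul
    (Complex.exp (φ * Complex.I))).const_mul (p : ℂ)
  obtain ⟨C, -, hC⟩ := exists_exp_mul_rpow_norm_hankelRay_le p hφ hφ' hc
  have hd : ∀ r, hankelRay φ c r ∈ Complex.slitPlane → HasDerivAt (fun r =>
      Complex.exp (hankelRay φ c r) * hankelRay φ c r ^ (p : ℂ)) _ r := fun r hr =>
    (hasDerivAt_exp_mul_cpow hr p).comp r hasDerivAt_hankelRay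
  have h3 := integral_Ioi_of_hasDerivAt_of_tendsto (a := 0)
    (hd 0 (by
      rw [hankelRay_zero]; exact Or.inl (by simpa using hc))).continuousAt.continuousWithinAt
    (fun r hr => hd r (hankelRay_mem_slitPlane hφ hr)) ?_
    (tendsto_exp_mul_cpow_hankelRay hφ' hC)
  · rw [hankelRay_zero] at h3
    unfold hankelIntegral
    rw [← integral_const_mul, ← integral_add h1 h2]
    convert h3 using 1
    · congr 1; ext r; ring
    · rw [Complex.ofReal_mul, Complex.ofReal_cpow hc.le, Complex.ofReal_exp]; ring
  · refine (h1.add h2).congr (.of_forall fun r => ?_)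
    simp only [Pi.add_apply]; ring

lemma exists_exp_mul_rpow_norm_hankelRay_le_of_abs_le {p R : ℝ} (hp : 0 ≤ p)
    (hφ' : Real.cos φ < 0) (hR : 0 < R) : ∃ C : ℝ, 0 < C ∧ ∀ c, |c| ≤ R → ∀ r, 0 < r →
      ‖Complex.exp (hankelRay φ c r)‖ * ‖hankelRay φ c r‖ ^ p ≤
        C * Real.exp (Real.cos φ / 2 * r) := by
  obtain ⟨C, hC, h⟩ := exists_rpow_le_mul_exp p hp (δ := -Real.cos φ / 2) (by linarith)
  refine ⟨Real.exp R * (C * Real.exp (-Real.cos φ / 2 * R)), by positivity, fun c hc r hr => ?_⟩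
  have h1 : ‖hankelRay φ c r‖ ^ p ≤ C * Real.exp (-Real.cos φ / 2 * (R + r)) :=
    (Real.rpow_le_rpow (norm_nonneg _) ((norm_hankelRay_le hr.le).trans (by linarith)) hp).trans
      (h _ (by linarith))
  rw [norm_exp_hankelRay]
  calc _ ≤ Real.exp R * Real.exp (Real.cos φ * r) *
        (C * Real.exp (-Real.cos φ / 2 * (R + r))) := by
        gcongr; exact (le_abs_self c).trans hc
    _ = Real.exp R * C * (Real.exp (Real.cos φ * r) *
        Real.exp (-Real.cos φ / 2 * (R + r))) := by ring
    _ = Real.exp R * C * (Real.exp (-Real.cos φ / 2 * R) * Real.exp (Real.cos φ / 2 * r)) := by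
        rw [← Real.exp_add, ← Real.exp_add]; ring_nf
    _ = _ := by ring

lemma hasDerivAt_hankelIntegral_left {a : ℝ} (ha : 1 ≤ a) (hφ : 0 < Real.sin φ)
    (hφ' : Real.cos φ < 0) (hc : 0 ≤ c) :
    HasDerivAt (fun c => hankelIntegral φ c a) (-((Real.exp c * c ^ a : ℝ) : ℂ)) c := by
  have hR : 0 < |c| + 1 := by positivity
  obtain ⟨C₁, hC₁, h₁⟩ :=
    exists_exp_mul_rpow_norm_hankelRay_le_of_abs_le (p := a) (by linarith) hφ' hR
  obtain ⟨C₂, hC₂, h₂⟩ :=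
    exists_exp_mul_rpow_norm_hankelRay_le_of_abs_le (p := a - 1) (by linarith) hφ' hR
  have hball : ∀ x ∈ Metric.ball c 1, |x| ≤ |c| + 1 := fun x hx => by
    rw [Metric.mem_ball, Real.dist_eq] at hx
    have := abs_sub_abs_le_abs_sub x c
    linarith
  have hw : ‖Complex.exp (φ * Complex.I)‖ = 1 := Complex.norm_exp_ofReal_mul_I φ
  have hδ : Real.cos φ / 2 < 0 := by linarith
  set F' : ℝ → ℝ → ℂ := fun y r => Complex.exp (φ * Complex.I) *
    (Complex.exp (hankelRay φ y r) * hankelRay φ y r ^ (a : ℂ) +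
      a * (Complex.exp (hankelRay φ y r) * hankelRay φ y r ^ ((a - 1 : ℝ) : ℂ))) with hF'
  have hmain := hasDerivAt_integral_of_dominated_loc_of_deriv_le (μ := volume.restrict (Ioi 0))
    (F := fun (y : ℝ) (r : ℝ) => Complex.exp (φ * Complex.I) *
      (Complex.exp (hankelRay φ y r) * hankelRay φ y r ^ (a : ℂ))) (x₀ := c) (F' := F')
    (bound := fun r => (C₁ + a * C₂) * Real.exp (Real.cos φ / 2 * r))
    (Metric.ball_mem_nhds c one_pos)
    (.of_forall fun y => ((measurable_exp_mul_cpow_hankelRay _).const_mul _).aestronglyMeasurable)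
    ?_ ?_ ?_ ((integrableOn_exp_mul_Ioi hδ 0).const_mul _) ?_
  · obtain ⟨hint, hder⟩ := hmain
    refine hder.congr_deriv ?_
    have hd : ∀ r, 0 < r → HasDerivAt (fun r =>
        Complex.exp (hankelRay φ c r) * hankelRay φ c r ^ (a : ℂ)) (F' c r) r := fun r hr => by
      rw [hF']
      refine ((hasDerivAt_exp_mul_cpow (hankelRay_mem_slitPlane hφ hr) a).comp r
        hasDerivAt_hankelRay).congr_deriv ?_
      ring
    have hcont : ContinuousAt (fun r =>
        Complex.exp (hankelRay φ c r) * hankelRay φ c r ^ (a : ℂ)) 0 := by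
      have h0 : ContinuousAt (hankelRay φ c) 0 := hasDerivAt_hankelRay.continuousAt
      refine (Complex.continuous_exp.continuousAt.comp h0).mul
        (ContinuousAt.comp (g := fun z : ℂ => z ^ (a : ℂ)) ?_ h0)
      refine Complex.continuousAt_cpow_const_of_re_pos (Or.inl ?_) ?_
      · rw [hankelRay_zero]; simpa using hc
      · simp only [Complex.ofReal_re]; linarith
    have := integral_Ioi_of_hasDerivAt_of_tendsto hcont.continuousWithinAt
      (fun r hr => hd r hr) hint
      (tendsto_exp_mul_cpow_hankelRay hφ' (h₁ c (by linarith)))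
    rw [this, hankelRay_zero, zero_sub, Complex.ofReal_mul, Complex.ofReal_cpow hc,
      Complex.ofReal_exp]
  · refine (integrableOn_Ioi_of_norm_le_exp (C := C₁) hδ
      ((measurable_exp_mul_cpow_hankelRay _).const_mul _) fun r hr => ?_)
    rw [norm_mul, hw, one_mul, norm_mul, Complex.norm_cpow_real]
    exact h₁ c (by linarith) r hr
  · exact (((measurable_exp_mul_cpow_hankelRay _).add
      ((measurable_exp_mul_cpow_hankelRay _).const_mul _)).const_mul _).aestronglyMeasurable
  · refine (ae_restrict_iff' measurableSet_Ioi).2 (.of_forall fun r hr x hx => ?_)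
    rw [hF']
    simp only [norm_mul, hw, one_mul]
    refine (norm_add_le _ _).trans ?_
    simp only [norm_mul, Complex.norm_cpow_real, Complex.norm_real, Real.norm_eq_abs,
      abs_of_nonneg (zero_le_one.trans ha)]
    have e1 := h₁ x (hball x hx) r hr
    have e2 := mul_le_mul_of_nonneg_left (h₂ x (hball x hx) r hr) (zero_le_one.trans ha)
    linarith
  · refine (ae_restrict_iff' measurableSet_Ioi).2 (.of_forall fun r hr x _ => ?_)
    have := (hasDerivAt_exp_mul_cpow (hankelRay_mem_slitPlane (c := x) hφ hr) a).comp x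
      (hasDerivAt_hankelRay_left (φ := φ) (r := r))
    rw [mul_one] at this
    exact this.const_mul _

lemma hankelIntegral_im_eq_zero_left {a : ℝ} (ha : 1 ≤ a) (hφ : 0 < Real.sin φ)
    (hφ' : Real.cos φ < 0) (hc : 0 ≤ c) :
    (hankelIntegral φ c a).im = (hankelIntegral φ 0 a).im := by
  have hd : ∀ x, 0 ≤ x → HasDerivAt (fun c => (hankelIntegral φ c a).im) 0 x := fun x hx => by
    have := Complex.imCLM.hasFDerivAt.comp_hasDerivAt x
      (hasDerivAt_hankelIntegral_left ha hφ hφ' hx)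
    simpa [-Complex.ofReal_mul, -Complex.ofReal_exp, Function.comp_def]
      using this
  exact constant_of_has_deriv_right_zero (f := fun c => (hankelIntegral φ c a).im)
    (fun x hx => (hd x hx.1).continuousAt.continuousWithinAt)
    (fun x hx => (hd x hx.1).hasDerivWithinAt) c (right_mem_Icc.2 hc)

lemma integrableOn_rpow_mul_exp_Ioi {s δ : ℝ} (hs : -1 < s) (hδ : δ < 0) :
    IntegrableOn (fun r : ℝ => r ^ s * Real.exp (δ * r)) (Ioi 0) := by
  simpa using integrableOn_rpow_mul_exp_neg_mul_rpow hs one_pos (neg_pos.2 hδ)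

/-- Rotating the ray of integration in the Euler integral for the Gamma function. -/
lemma integral_rpow_mul_exp_rotate {a : ℝ} (ha : 0 < a) (hφ : π / 2 < φ) (hφ' : φ ≤ π) :
    ∫ r in Ioi (0 : ℝ), ((r ^ a : ℝ) : ℂ) *
      Complex.exp (φ * (a + 1) * Complex.I + r * Complex.exp (φ * Complex.I)) =
      Complex.exp (π * (a + 1) * Complex.I) * Real.Gamma (a + 1) := by
  set G : ℝ → ℝ → ℂ := fun x r => ((r ^ a : ℝ) : ℂ) *
      Complex.exp (x * (a + 1) * Complex.I + r * Complex.exp (x * Complex.I)) with hG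
  set G' : ℝ → ℝ → ℂ := fun x r => ((r ^ a : ℝ) : ℂ) *
      (Complex.exp (x * (a + 1) * Complex.I + r * Complex.exp (x * Complex.I)) *
      ((a + 1) * Complex.I + r * (Complex.exp (x * Complex.I) * Complex.I))) with hG'
  have hmeas : ∀ x, Measurable (G x) := fun x => by rw [hG]; fun_prop
  have hmeas' : ∀ x, Measurable (G' x) := fun x => by rw [hG']; fun_prop
  have hnexp : ∀ x r : ℝ, ‖Complex.exp (x * (a + 1) * Complex.I +
      r * Complex.exp (x * Complex.I))‖ = Real.exp (Real.cos x * r) := fun x r => by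
    rw [Complex.norm_exp]
    congr 1
    have : (x : ℂ) * (a + 1) * Complex.I = ((x * (a + 1) : ℝ) : ℂ) * Complex.I := by push_cast; ring
    rw [Complex.add_re, this, Complex.re_ofReal_mul, Complex.re_ofReal_mul,
      Complex.exp_ofReal_mul_I_re, Complex.I_re]
    ring
  have hd : ∀ x, π / 2 < x → x ≤ π → HasDerivAt (fun x => ∫ r in Ioi (0 : ℝ), G x r) 0 x := by
    intro x hx hx'
    have hcos : Real.cos x < 0 := Real.cos_neg_of_pi_div_two_lt_of_lt hx (by linarith [Real.pi_pos])
    have hδ : Real.cos x / 2 < 0 := by linarith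
    have hmain := hasDerivAt_integral_of_dominated_loc_of_deriv_le (μ := volume.restrict (Ioi 0))
      (F := G) (x₀ := x) (F' := G') (s := {y | Real.cos y < Real.cos x / 2})
      (bound := fun r => (a + 1) * (r ^ a * Real.exp (Real.cos x / 2 * r)) +
        r ^ (a + 1) * Real.exp (Real.cos x / 2 * r))
      ((isOpen_lt Real.continuous_cos continuous_const).mem_nhds (by simp; linarith))
      (.of_forall fun y => (hmeas y).aestronglyMeasurable)
      ?_ (hmeas' x).aestronglyMeasurable ?_
      (((integrableOn_rpow_mul_exp_Ioi (by linarith) hδ).const_mul _).add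
        (integrableOn_rpow_mul_exp_Ioi (by linarith) hδ)) ?_
    · obtain ⟨hint, hder⟩ := hmain
      refine hder.congr_deriv ?_
      have hlim : Tendsto (fun r : ℝ => Complex.I * (((r ^ (a + 1) : ℝ) : ℂ) *
          Complex.exp (x * (a + 1) * Complex.I + r * Complex.exp (x * Complex.I)))) atTop
          (nhds 0) := by
        have h0 : Tendsto (fun r : ℝ => r ^ (a + 1) * Real.exp (-(-Real.cos x) * r)) atTop
            (nhds 0) := tendsto_rpow_mul_exp_neg_mul_atTop_nhds_zero _ _ (by linarith)
        refine squeeze_zero_norm' ?_ h0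
        filter_upwards [eventually_gt_atTop 0] with r hr
        rw [norm_mul, Complex.norm_I, one_mul, norm_mul, hnexp, Complex.norm_real,
          Real.norm_of_nonneg (by positivity), neg_neg]
      have hcont : Continuous (fun r : ℝ => Complex.I * (((r ^ (a + 1) : ℝ) : ℂ) *
          Complex.exp (x * (a + 1) * Complex.I + r * Complex.exp (x * Complex.I)))) := by
        have : Continuous fun r : ℝ => r ^ (a + 1) :=
          Real.continuous_rpow_const (by linarith)
        fun_prop
      have := integral_Ioi_of_hasDerivAt_of_tendsto (a := 0) (f' := G' x)
        hcont.continuousAt.continuousWithinAt ?_ hint hlim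
      · rw [this, Real.zero_rpow (by linarith)]; simp
      · intro r hr
        have hr : 0 < r := hr
        have e1 : HasDerivAt (fun r : ℝ => ((r ^ (a + 1) : ℝ) : ℂ))
            (((a + 1) * r ^ a : ℝ) : ℂ) r := by
          have := (Real.hasDerivAt_rpow_const (p := a + 1) (Or.inl hr.ne')).ofReal_comp
          simpa using this
        have e2 : HasDerivAt (fun r : ℝ =>
            Complex.exp (x * (a + 1) * Complex.I + r * Complex.exp (x * Complex.I))) _ r :=
          (((Complex.ofRealCLM.hasDerivAt (x := r)).mul_const
            (Complex.exp (x * Complex.I))).const_add (x * (a + 1) * Complex.I)).cexp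
        refine ((e1.mul e2).const_mul Complex.I).congr_deriv ?_
        rw [hG', Real.rpow_add_one hr.ne']
        simp only [Complex.ofRealCLM_apply]
        push_cast
        ring
    · refine (integrableOn_rpow_mul_exp_Ioi (s := a) (by linarith) hcos).mono'
        (hmeas x).aestronglyMeasurable
        ((ae_restrict_iff' measurableSet_Ioi).2 (.of_forall fun r hr => ?_))
      have hr : 0 < r := hr
      rw [hG, norm_mul, hnexp, Complex.norm_real, Real.norm_of_nonneg (by positivity)]
    · refine (ae_restrict_iff' measurableSet_Ioi).2 (.of_forall fun r hr y hy => ?_)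
      have hr : 0 < r := hr
      rw [hG']
      simp only [norm_mul, hnexp, Complex.norm_real, Real.norm_eq_abs,
        abs_of_pos (Real.rpow_pos_of_pos hr a)]
      have h1 : ‖((a : ℂ) + 1) * Complex.I + r * (Complex.exp (y * Complex.I) * Complex.I)‖ ≤
          (a + 1) + r := by
        refine (norm_add_le _ _).trans (add_le_add ?_ ?_)
        · rw [norm_mul, Complex.norm_I, mul_one]
          exact (norm_add_le _ _).trans (by simp [abs_of_pos ha])
        · simp [Complex.norm_exp_ofReal_mul_I, abs_of_pos hr]
      have h2 : Real.exp (Real.cos y * r) ≤ Real.exp (Real.cos x / 2 * r) := by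
        have : Real.cos y < Real.cos x / 2 := hy
        gcongr
      calc _ ≤ r ^ a * (Real.exp (Real.cos x / 2 * r) * ((a + 1) + r)) := by gcongr
        _ = _ := by rw [Real.rpow_add_one hr.ne']; ring
    · refine .of_forall fun r y _ => ?_
      have e1 : HasDerivAt (fun y : ℝ => (y : ℂ)) 1 y := (hasDerivAt_id y).ofReal_comp
      refine (((((e1.mul_const ((a : ℂ) + 1)).mul_const Complex.I).add
        ((e1.mul_const Complex.I).cexp.const_mul (r : ℂ))).cexp).const_mul
          ((r ^ a : ℝ) : ℂ)).congr_deriv ?_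
      simp only [hG', Pi.add_apply]
      ring
  have hconst := constant_of_has_deriv_right_zero (f := fun x => ∫ r in Ioi (0 : ℝ), G x r)
    (fun x (hx : x ∈ Icc φ π) =>
      (hd x (hφ.trans_le hx.1) hx.2).continuousAt.continuousWithinAt)
    (fun x hx => (hd x (hφ.trans_le hx.1) hx.2.le).hasDerivWithinAt) π (right_mem_Icc.2 hφ')
  change ∫ r in Ioi (0 : ℝ), G φ r = _
  rw [← hconst]
  have : ∀ r ∈ Ioi (0 : ℝ), G π r = Complex.exp (π * (a + 1) * Complex.I) *
      ((Real.exp (-r) * r ^ ((a + 1) - 1) : ℝ) : ℂ) := fun r _ => by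
    simp only [hG]
    rw [Complex.exp_add, Complex.exp_pi_mul_I, add_sub_cancel_right]
    push_cast
    ring_nf
  rw [setIntegral_congr_fun measurableSet_Ioi this, integral_const_mul, integral_complex_ofReal,
    Real.Gamma_eq_integral (by linarith)]

lemma hankelIntegral_zero_left {a : ℝ} (ha : 0 < a) (hφ : π / 2 < φ) (hφ' : φ ≤ π) :
    hankelIntegral φ 0 a = Complex.exp (π * (a + 1) * Complex.I) * Real.Gamma (a + 1) := by
  rw [← integral_rpow_mul_exp_rotate ha hφ hφ']
  refine setIntegral_congr_fun measurableSet_Ioi fun r hr => ?_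
  have hr : 0 < r := hr
  have hne : (r : ℂ) * Complex.exp (φ * Complex.I) ≠ 0 :=
    mul_ne_zero (by exact_mod_cast hr.ne') (Complex.exp_ne_zero _)
  have hlog : Complex.log ((r : ℂ) * Complex.exp (φ * Complex.I)) =
      Real.log r + φ * Complex.I := by
    rw [Complex.log_ofReal_mul hr (Complex.exp_ne_zero _), Complex.log_exp] <;>
      simp <;> linarith [Real.pi_pos]
  simp only [hankelRay, Complex.ofReal_zero, zero_add]
  rw [Complex.cpow_def_of_ne_zero hne, hlog, Real.rpow_def_of_pos hr, Complex.ofReal_exp,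
    ← Complex.exp_add, ← Complex.exp_add, ← Complex.exp_add]
  congr 1
  push_cast
  ring

lemma continuous_hankelIntegral (hφ : 0 < Real.sin φ) (hφ' : Real.cos φ < 0) (hc : 0 < c) :
    Continuous fun p => hankelIntegral φ c p := by
  refine continuous_iff_continuousAt.2 fun p₀ => ?_
  refine continuousAt_of_dominated (bound := fun r => ‖Complex.exp (hankelRay φ c r) *
      hankelRay φ c r ^ ((p₀ - 1 : ℝ) : ℂ)‖ + ‖Complex.exp (hankelRay φ c r) *
      hankelRay φ c r ^ ((p₀ + 1 : ℝ) : ℂ)‖) ?_ ?_ ?_ ?_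
  · exact .of_forall fun p =>
      ((measurable_exp_mul_cpow_hankelRay _).const_mul _).aestronglyMeasurable
  · filter_upwards [Metric.ball_mem_nhds p₀ one_pos] with p hp
    rw [Metric.mem_ball, Real.dist_eq, abs_lt] at hp
    refine .of_forall fun r => ?_
    have hpos : 0 < ‖hankelRay φ c r‖ := (mul_pos hc hφ).trans_le le_norm_hankelRay
    simp only [norm_mul, Complex.norm_cpow_real, Complex.norm_exp_ofReal_mul_I, one_mul, ← mul_add]
    gcongr
    rcases le_total 1 ‖hankelRay φ c r‖ with h | h
    · exact (Real.rpow_le_rpow_of_exponent_le h (by linarith)).trans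
        (le_add_of_nonneg_left (by positivity))
    · exact (Real.rpow_le_rpow_of_exponent_ge hpos h (by linarith)).trans
        (le_add_of_nonneg_right (by positivity))
  · exact (integrableOn_exp_mul_cpow_hankelRay _ hφ hφ' hc).norm.add
      (integrableOn_exp_mul_cpow_hankelRay _ hφ hφ' hc).norm
  · refine .of_forall fun r => ?_
    have hne : hankelRay φ c r ≠ 0 :=
      norm_pos_iff.1 ((mul_pos hc hφ).trans_le le_norm_hankelRay)
    have : Continuous fun p : ℝ => hankelRay φ c r ^ (p : ℂ) :=
      Complex.continuous_ofReal.const_cpow (Or.inl hne)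
    exact (continuous_const.mul (continuous_const.mul this)).continuousAt

lemma continuous_one_div_Gamma : Continuous fun s : ℝ => (Real.Gamma s)⁻¹ := by
  have h : Continuous fun s : ℝ => ((Complex.Gamma s)⁻¹).re :=
    Complex.continuous_re.comp
      (Complex.differentiable_one_div_Gamma.continuous.comp Complex.continuous_ofReal)
  refine h.congr fun s => ?_
  rw [Complex.Gamma_ofReal, ← Complex.ofReal_inv, Complex.ofReal_re]

/-- The Hankel formula for the reciprocal of the Gamma function. -/
theorem hankelIntegral_im (hφ : π / 2 < φ) (hφ' : φ < π) (hc : 0 < c) (p : ℝ) :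
    (hankelIntegral φ c p).im = π * (Real.Gamma (-p))⁻¹ := by
  have hsin : 0 < Real.sin φ := Real.sin_pos_of_pos_of_lt_pi (by linarith [Real.pi_pos]) hφ'
  have hcos : Real.cos φ < 0 :=
    Real.cos_neg_of_pi_div_two_lt_of_lt hφ (by linarith [Real.pi_pos])
  have hbase : ∀ a, 1 ≤ a → (hankelIntegral φ c a).im = π * (Real.Gamma (-a))⁻¹ := fun a ha => by
    rw [hankelIntegral_im_eq_zero_left ha hsin hcos hc.le,
      hankelIntegral_zero_left (by linarith) hφ hφ'.le]
    have h1 : (π : ℂ) * (a + 1) * Complex.I = ((π * (a + 1) : ℝ) : ℂ) * Complex.I := by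
      push_cast; ring
    rw [h1, Complex.im_mul_ofReal, Complex.exp_ofReal_mul_I_im]
    have h2 := Real.Gamma_mul_Gamma_one_sub (-a)
    have h3 : 0 < Real.Gamma (a + 1) := Real.Gamma_pos_of_pos (by linarith)
    have h4 : Real.sin (π * (a + 1)) = Real.sin (π * -a) := by
      rw [mul_add, mul_one, Real.sin_add_pi, mul_neg, Real.sin_neg]
    have h5 : Real.Gamma (-a) = π / Real.sin (π * -a) / Real.Gamma (a + 1) := by
      rw [eq_div_iff h3.ne', ← h2]; ring_nf
    rw [h4, h5, inv_div, div_div_eq_mul_div]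
    field_simp
  have hnonint : ∀ n : ℕ, ∀ p : ℝ, (∀ k : ℤ, p ≠ k) → 1 ≤ p + n →
      (hankelIntegral φ c p).im = π * (Real.Gamma (-p))⁻¹ := by
    intro n
    induction n with
    | zero => intro p _ hp; exact hbase p (by simpa using hp)
    | succ n ih =>
      intro p hk hp
      have hp1 : p + 1 ≠ 0 := fun h => hk (-1) (by push_cast; linarith)
      have h1 := ih (p + 1) (fun k h => hk (k - 1) (by push_cast; linarith))
        (by push_cast at hp; linarith)
      have h2 := congrArg Complex.im (hankelIntegral_add_eq (p + 1) hsin hcos hc)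
      rw [Complex.add_im, Complex.im_ofReal_mul, Complex.neg_im, Complex.ofReal_im, h1,
        add_sub_cancel_right] at h2
      have h3 := Real.Gamma_add_one (neg_ne_zero.2 hp1)
      rw [show -(p + 1) + 1 = -p by ring] at h3
      rw [h3]
      have h4 : Real.Gamma (-(p + 1)) ≠ 0 := Real.Gamma_ne_zero fun m h => hk (m - 1) (by
        push_cast; linarith)
      field_simp at h2 ⊢
      linarith
  have hcont := Continuous.ext_on (Set.Countable.dense_compl ℝ
      (Set.countable_range (fun k : ℤ => (k : ℝ))))
    (Complex.continuous_im.comp (continuous_hankelIntegral (c := c) hsin hcos hc))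
    (continuous_const.mul (continuous_one_div_Gamma.comp continuous_neg) :
      Continuous fun p : ℝ => π * (Real.Gamma (-p))⁻¹) fun p hp => by
      obtain ⟨n, hn⟩ := exists_nat_ge (1 - p)
      exact hnonint n p (fun k h => hp ⟨k, h.symm⟩) (by linarith)
  exact congrFun hcont p

/-- A representation of the Wright function by an integral along a Hankel contour. -/
theorem hasSum_wright_hankel {β : ℝ} (hβ0 : 0 < β) (hβ1 : β < 1) (hφ : π / 2 < φ) (hφ' : φ < π)
    (hc : 0 < c) {x : ℝ} (hx : 0 ≤ x) :
    HasSum (fun k : ℕ => (-x) ^ k / ((Nat.factorial k : ℝ) * Real.Gamma (1 - β * (k + 1))))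
      (π⁻¹ * (∫ r in Ioi (0 : ℝ), Complex.exp (φ * Complex.I) *
        (Complex.exp (hankelRay φ c r) * hankelRay φ c r ^ ((β - 1 : ℝ) : ℂ)) *
        Complex.exp (-(x * hankelRay φ c r ^ (β : ℂ)))).im) := by
  have hsin : 0 < Real.sin φ := Real.sin_pos_of_pos_of_lt_pi (by linarith [Real.pi_pos]) hφ'
  have hcos : Real.cos φ < 0 :=
    Real.cos_neg_of_pi_div_two_lt_of_lt hφ (by linarith [Real.pi_pos])
  have hpos : ∀ r, 0 < ‖hankelRay φ c r‖ := fun r => (mul_pos hc hsin).trans_le le_norm_hankelRay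
  have hne : ∀ r, hankelRay φ c r ≠ 0 := fun r => norm_pos_iff.1 (hpos r)
  have hw : ‖Complex.exp (φ * Complex.I)‖ = 1 := Complex.norm_exp_ofReal_mul_I φ
  have hpow : ∀ (k : ℕ) r, hankelRay φ c r ^ ((β * (k + 1) - 1 : ℝ) : ℂ) =
      hankelRay φ c r ^ ((β - 1 : ℝ) : ℂ) * (hankelRay φ c r ^ (β : ℂ)) ^ k := fun k r => by
    rw [← Complex.cpow_mul_nat, ← Complex.cpow_add _ _ (hne r)]
    congr 1; push_cast; ring
  set F : ℕ → ℝ → ℂ := fun k r => (((-x) ^ k / (Nat.factorial k : ℝ) : ℝ) : ℂ) *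
    (Complex.exp (φ * Complex.I) * (Complex.exp (hankelRay φ c r) *
      hankelRay φ c r ^ ((β * (k + 1) - 1 : ℝ) : ℂ))) with hF
  have hmeas : ∀ k, Measurable (F k) := fun k =>
    ((measurable_exp_mul_cpow_hankelRay _).const_mul _).const_mul _
  set B : ℕ → ℝ → ℝ := fun k r => ‖Complex.exp (hankelRay φ c r)‖ *
    ‖hankelRay φ c r‖ ^ (β - 1) * ((x * ‖hankelRay φ c r‖ ^ β) ^ k / (Nat.factorial k : ℝ)) with hB
  have hBsum : ∀ r, HasSum (fun k => B k r) (‖Complex.exp (hankelRay φ c r)‖ *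
      ‖hankelRay φ c r‖ ^ (β - 1) * Real.exp (x * ‖hankelRay φ c r‖ ^ β)) := fun r => by
    have := NormedSpace.expSeries_div_hasSum_exp (x * ‖hankelRay φ c r‖ ^ β)
    rw [← Real.exp_eq_exp_ℝ] at this
    exact this.mul_left _
  have hsum := hasSum_integral_of_dominated_convergence (μ := volume.restrict (Ioi 0)) (F := F)
    (f := fun r => Complex.exp (φ * Complex.I) *
        (Complex.exp (hankelRay φ c r) * hankelRay φ c r ^ ((β - 1 : ℝ) : ℂ)) *
        Complex.exp (-(x * hankelRay φ c r ^ (β : ℂ)))) B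
    (fun k => (hmeas k).aestronglyMeasurable) ?_ ?_ ?_ ?_
  · have h1 := (Complex.imCLM.hasSum hsum).mul_left π⁻¹
    simp only [Complex.imCLM_apply] at h1
    refine h1.congr_fun fun k => ?_
    simp only [hF]
    rw [integral_const_mul, Complex.im_ofReal_mul]
    change _ = π⁻¹ * (_ * (hankelIntegral φ c (β * (k + 1) - 1)).im)
    rw [hankelIntegral_im hφ hφ' hc, neg_sub]
    have := Real.pi_pos
    field_simp
  · refine fun k => .of_forall fun r => ?_
    simp only [hF, hB, hpow, norm_mul, norm_pow, hw, one_mul, Complex.norm_cpow_real,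
      Complex.norm_real, norm_div, norm_neg, Real.norm_of_nonneg hx, Real.norm_natCast]
    exact le_of_eq (by rw [mul_pow]; ring)
  · exact .of_forall fun r => (hBsum r).summable
  · simp_rw [fun r => (hBsum r).tsum_eq]
    obtain ⟨C, hC, hle⟩ := exists_exp_mul_rpow_norm_hankelRay_le (β - 1) hsin hcos hc
    have hε : 0 < -Real.cos φ / (4 * (x + 1)) := div_pos (by linarith) (by linarith)
    obtain ⟨K, hK, hKle⟩ := exists_rpow_le_mul_add hβ0 hβ1 hε
    set ε := -Real.cos φ / (4 * (x + 1)) with hεd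
    have hxε : x * ε ≤ -Real.cos φ / 4 := by
      rw [hεd, mul_div_assoc', div_le_div_iff₀ (by linarith) (by norm_num)]
      nlinarith
    have hδ : Real.cos φ / 4 < 0 := by linarith
    refine ((integrableOn_exp_mul_Ioi hδ 0).const_mul
      (C * Real.exp (x * ε * c + x * K))).mono' ?_
      ((ae_restrict_iff' measurableSet_Ioi).2 (.of_forall fun r hr => ?_))
    · have := measurable_hankelRay (φ := φ) (c := c)
      exact Measurable.aestronglyMeasurable (by fun_prop)
    · have hr : 0 < r := hr
      rw [Real.norm_of_nonneg (by positivity)]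
      have h1 : x * ‖hankelRay φ c r‖ ^ β ≤ x * ε * c + x * K + -Real.cos φ / 4 * r := by
        have e1 := mul_le_mul_of_nonneg_left (hKle _ (hpos r)) hx
        have e2 := norm_hankelRay_le (φ := φ) (c := c) hr.le
        rw [abs_of_pos hc] at e2
        have e3 := mul_le_mul_of_nonneg_left e2 (mul_nonneg hx hε.le)
        have e4 := mul_le_mul_of_nonneg_right hxε hr.le
        nlinarith
      calc _ ≤ C * Real.exp (Real.cos φ / 2 * r) *
            Real.exp (x * ε * c + x * K + -Real.cos φ / 4 * r) :=
            mul_le_mul (hle r hr) (Real.exp_le_exp.2 h1) (Real.exp_pos _).le (by positivity)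
        _ = _ := by
            rw [Real.exp_add (x * ε * c + x * K)]
            have : Real.exp (Real.cos φ / 4 * r) =
                Real.exp (Real.cos φ / 2 * r) * Real.exp (-Real.cos φ / 4 * r) := by
              rw [← Real.exp_add]; ring_nf
            rw [this]; ring
  · refine .of_forall fun r => ?_
    have := NormedSpace.expSeries_div_hasSum_exp (-(x * hankelRay φ c r ^ (β : ℂ)))
    rw [← Complex.exp_eq_exp_ℂ] at this
    refine (this.mul_left _).congr_fun fun k => ?_
    simp only [hF, hpow]
    push_cast
    rw [← neg_mul, mul_pow]
    ring

lemma exists_le_re_hankelRay_cpow {β : ℝ} (hβ0 : 0 < β) (hφ0 : 0 < φ) (hφ' : φ < π)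
    (hβφ : β * φ < π / 2) {A : ℝ} (hA : 0 < A) :
    ∃ c, 0 < c ∧ ∀ r, 0 < r → A ≤ (hankelRay φ c r ^ (β : ℂ)).re := by
  have hsin : 0 < Real.sin φ := Real.sin_pos_of_pos_of_lt_pi hφ0 hφ'
  have hcosβ : 0 < Real.cos (φ * β) :=
    Real.cos_pos_of_mem_Ioo ⟨by nlinarith [Real.pi_pos], by linarith⟩
  set X := (A / Real.cos (φ * β)) ^ (1 / β) with hX
  have hX0 : 0 < X := by positivity
  refine ⟨X / Real.sin φ, by positivity, fun r hr => ?_⟩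
  have h1 : X ≤ ‖hankelRay φ (X / Real.sin φ) r‖ := by
    simpa [div_mul_cancel₀ _ hsin.ne'] using
      le_norm_hankelRay (φ := φ) (c := X / Real.sin φ) (r := r)
  have h2 : Real.cos (φ * β) ≤ Real.cos ((hankelRay φ (X / Real.sin φ) r).arg * β) := by
    have h0 := arg_hankelRay_nonneg (c := X / Real.sin φ) hsin hr
    have h3 := arg_hankelRay_le (r := r) hφ0 hsin (show 0 < X / Real.sin φ by positivity)
    exact Real.cos_le_cos_of_nonneg_of_le_pi (by positivity) (by linarith [Real.pi_pos])
      (by gcongr)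
  rw [Complex.cpow_ofReal_re]
  calc A = X ^ β * Real.cos (φ * β) := by
        rw [hX, ← Real.rpow_mul (by positivity), one_div_mul_cancel hβ0.ne', Real.rpow_one,
          div_mul_cancel₀ _ hcosβ.ne']
    _ ≤ _ := by gcongr

end HankelRay

/-- Wright-type transform of the exponential function (convergent integral):
`∫_0^∞ g_β(s;t) e^s ds = E_β(t^β) = ∑ t^{nβ}/Γ(nβ+1)`. -/
theorem wrightTransform_exp (β t : ℝ) (hβ0 : 0 < β) (hβ1 : β < 1) (ht : 0 < t) :
    MeasureTheory.IntegrableOn (fun s => wrightG β s t * Real.exp s) (Set.Ioi (0:ℝ)) ∧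
      (∫ s in Set.Ioi (0:ℝ), wrightG β s t * Real.exp s) = mittagLeffler β 1 (t ^ β) ∧
      mittagLeffler β 1 (t ^ β)
        = ∑' n : ℕ, t ^ ((n : ℝ) * β) / Real.Gamma ((n : ℝ) * β + 1) := by
  set T := t ^ β with hT
  have hT0 : 0 < T := Real.rpow_pos_of_pos ht β
  have hpi := Real.pi_pos
  obtain ⟨φ, hφ, hφ', hβφ⟩ : ∃ φ, π / 2 < φ ∧ φ < π ∧ β * φ < π / 2 := by
    refine ⟨π / (1 + β), ?_, ?_, ?_⟩
    · exact div_lt_div_of_pos_left hpi (by linarith) (by linarith)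
    · exact div_lt_self hpi (by linarith)
    · rw [mul_div_assoc', div_lt_div_iff₀ (by linarith) two_pos]
      nlinarith
  have hsin : 0 < Real.sin φ := Real.sin_pos_of_pos_of_lt_pi (by linarith) hφ'
  have hcos : Real.cos φ < 0 := Real.cos_neg_of_pi_div_two_lt_of_lt hφ (by linarith)
  have hδ : Real.cos φ / 2 < 0 := by linarith
  obtain ⟨c, hc, hre⟩ := exists_le_re_hankelRay_cpow hβ0 (by linarith) hφ' hβφ
    (show 0 < 2 * T by positivity)
  have hw : ‖Complex.exp (φ * Complex.I)‖ = 1 := Complex.norm_exp_ofReal_mul_I φ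
  have hne : ∀ r, hankelRay φ c r ≠ 0 := fun r =>
    norm_pos_iff.1 ((mul_pos hc hsin).trans_le le_norm_hankelRay)
  have hTC : (T : ℂ) ≠ 0 := by exact_mod_cast hT0.ne'
  set w := Complex.exp (φ * Complex.I) with hwd
  set K : ℝ → ℝ → ℂ := fun s r => w * (Complex.exp (hankelRay φ c r) *
    hankelRay φ c r ^ ((β - 1 : ℝ) : ℂ)) *
      Complex.exp ((1 - hankelRay φ c r ^ (β : ℂ) / T) * s) with hK
  have hmeas := measurable_hankelRay (φ := φ) (c := c)
  have hKint : Integrable (Function.uncurry K)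
      ((volume.restrict (Ioi 0)).prod (volume.restrict (Ioi 0))) := by
    obtain ⟨C, -, hC⟩ := exists_exp_mul_rpow_norm_hankelRay_le (β - 1) hsin hcos hc
    refine ((integrableOn_exp_mul_Ioi (a := -1) (by norm_num) 0).mul_prod
      ((integrableOn_exp_mul_Ioi hδ 0).const_mul C)).mono' ?_ ?_
    · have h2 : Measurable fun z : ℝ × ℝ => hankelRay φ c z.2 := hmeas.comp measurable_snd
      refine Measurable.aestronglyMeasurable ?_
      simp only [hK, Function.uncurry_def]
      fun_prop
    · rw [Measure.prod_restrict]
      refine (ae_restrict_iff' (measurableSet_Ioi.prod measurableSet_Ioi)).2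
        (.of_forall fun z hz => ?_)
      obtain ⟨hs, hr⟩ : 0 < z.1 ∧ 0 < z.2 := hz
      simp only [Function.uncurry_def, hK, norm_mul, hw, one_mul, Complex.norm_cpow_real]
      rw [mul_comm]
      refine mul_le_mul ?_ (hC _ hr) (by positivity) (Real.exp_pos _).le
      rw [Complex.norm_exp, Complex.re_mul_ofReal, Complex.sub_re, Complex.one_re,
        Complex.div_ofReal_re]
      have : 2 ≤ (hankelRay φ c z.2 ^ (β : ℂ)).re / T := (le_div_iff₀ hT0).2 (hre _ hr)
      exact Real.exp_le_exp.2 (mul_le_mul_of_nonneg_right (by linarith) hs.le)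
  have hrep : ∀ s ∈ Ioi (0 : ℝ), wrightG β s t * Real.exp s =
      T⁻¹ * π⁻¹ * (∫ r in Ioi (0 : ℝ), K s r).im := fun s hs => by
    have h1 := (hasSum_wright_hankel hβ0 hβ1 hφ hφ' hc
      (div_nonneg (le_of_lt hs) hT0.le)).tsum_eq
    rw [wrightG, Real.rpow_neg ht.le, ← hT, neg_div, h1]
    have h2 : ∫ r in Ioi (0 : ℝ), K s r = (Real.exp s : ℂ) *
        ∫ r in Ioi (0 : ℝ), w * (Complex.exp (hankelRay φ c r) *
          hankelRay φ c r ^ ((β - 1 : ℝ) : ℂ)) *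
          Complex.exp (-((s / T : ℝ) * hankelRay φ c r ^ (β : ℂ))) := by
      rw [← integral_const_mul]
      congr 1
      ext r
      have : (1 - hankelRay φ c r ^ (β : ℂ) / T) * s =
          s + -((s / T : ℝ) * hankelRay φ c r ^ (β : ℂ)) := by
        push_cast; ring
      simp only [hK]
      rw [this, Complex.exp_add, Complex.ofReal_exp]
      ring
    rw [h2, Complex.im_ofReal_mul]
    ring
  have hKs : ∀ r ∈ Ioi (0 : ℝ), ∫ s in Ioi (0 : ℝ), K s r =
      T * (w * (Complex.exp (hankelRay φ c r) *
      (hankelRay φ c r ^ ((β - 1 : ℝ) : ℂ) * (hankelRay φ c r ^ (β : ℂ) - T)⁻¹))) := by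
    intro r hr
    have hre' : (1 - hankelRay φ c r ^ (β : ℂ) / T).re < 0 := by
      rw [Complex.sub_re, Complex.one_re, Complex.div_ofReal_re]
      have : 2 ≤ (hankelRay φ c r ^ (β : ℂ)).re / T := (le_div_iff₀ hT0).2 (hre _ hr)
      linarith
    have hne' : hankelRay φ c r ^ (β : ℂ) - T ≠ 0 := fun h => by
      rw [sub_eq_zero.1 h, div_self hTC] at hre'
      simp at hre'
    simp only [hK]
    rw [integral_const_mul, integral_exp_mul_complex_Ioi hre' 0]
    have h1 : 1 - hankelRay φ c r ^ (β : ℂ) / T = -((hankelRay φ c r ^ (β : ℂ) - T) / T) := by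
      field_simp; ring
    rw [h1, Complex.ofReal_zero, mul_zero, Complex.exp_zero, neg_div_neg_eq, one_div_div]
    ring
  have hML : HasSum (fun k : ℕ => T ^ k / Real.Gamma (β * k + 1))
      (π⁻¹ * (∫ r in Ioi (0 : ℝ), w * (Complex.exp (hankelRay φ c r) *
        (hankelRay φ c r ^ ((β - 1 : ℝ) : ℂ) * (hankelRay φ c r ^ (β : ℂ) - T)⁻¹))).im) := by
    obtain ⟨C, hC0, hC⟩ := exists_exp_mul_rpow_norm_hankelRay_le (-1) hsin hcos hc
    have hnorm : ∀ r, 0 < r → ‖(T : ℂ) * (hankelRay φ c r ^ (β : ℂ))⁻¹‖ ≤ 1 / 2 := fun r hr => by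
      have h1 := (hre r hr).trans (Complex.re_le_norm _)
      rw [norm_mul, norm_inv, Complex.norm_real, Real.norm_of_nonneg hT0.le, ← div_eq_mul_inv,
        div_le_div_iff₀ (by linarith) two_pos]
      linarith
    have hpow : ∀ (k : ℕ) r, hankelRay φ c r ^ ((-(β * k + 1) : ℝ) : ℂ) =
        hankelRay φ c r ^ ((-1 : ℝ) : ℂ) * ((hankelRay φ c r ^ (β : ℂ))⁻¹) ^ k := fun k r => by
      rw [← Complex.cpow_neg, ← Complex.cpow_mul_nat, ← Complex.cpow_add _ _ (hne r)]
      congr 1; push_cast; ring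
    have hsum := hasSum_integral_of_dominated_convergence (μ := volume.restrict (Ioi 0))
      (F := fun (k : ℕ) r => ((T ^ k : ℝ) : ℂ) * (w * (Complex.exp (hankelRay φ c r) *
        hankelRay φ c r ^ ((-(β * k + 1) : ℝ) : ℂ))))
      (f := fun r => w * (Complex.exp (hankelRay φ c r) *
        (hankelRay φ c r ^ ((β - 1 : ℝ) : ℂ) * (hankelRay φ c r ^ (β : ℂ) - T)⁻¹)))
      (fun k r => C * Real.exp (Real.cos φ / 2 * r) * (1 / 2) ^ k)
      (fun k => (((measurable_exp_mul_cpow_hankelRay _).const_mul _).const_mul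
        _).aestronglyMeasurable) ?_ ?_ ?_ ?_
    · have h1 := (Complex.imCLM.hasSum hsum).mul_left π⁻¹
      simp only [Complex.imCLM_apply] at h1
      refine h1.congr_fun fun k => ?_
      rw [integral_const_mul, Complex.im_ofReal_mul]
      change _ = π⁻¹ * (_ * (hankelIntegral φ c (-(β * k + 1))).im)
      rw [hankelIntegral_im hφ hφ' hc, neg_neg]
      field_simp
    · refine fun k => (ae_restrict_iff' measurableSet_Ioi).2 (.of_forall fun r hr => ?_)
      have e1 : ((T ^ k : ℝ) : ℂ) * (w * (Complex.exp (hankelRay φ c r) *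
          hankelRay φ c r ^ ((-(β * k + 1) : ℝ) : ℂ))) = w * (Complex.exp (hankelRay φ c r) *
          hankelRay φ c r ^ ((-1 : ℝ) : ℂ)) * (T * (hankelRay φ c r ^ (β : ℂ))⁻¹) ^ k := by
        rw [hpow, mul_pow]; push_cast; ring
      rw [e1, norm_mul, norm_mul, hw, one_mul, norm_mul, norm_pow, Complex.norm_cpow_real]
      exact mul_le_mul (hC r hr) (pow_le_pow_left₀ (norm_nonneg _) (hnorm r hr) k)
        (by positivity) (by positivity)
    · exact .of_forall fun r =>
        (summable_geometric_of_lt_one (by norm_num) (by norm_num)).mul_left _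
    · simp_rw [tsum_mul_left]
      exact ((integrableOn_exp_mul_Ioi hδ 0).const_mul C).mul_const _
    · refine (ae_restrict_iff' measurableSet_Ioi).2 (.of_forall fun r hr => ?_)
      have hb : hankelRay φ c r ^ (β : ℂ) ≠ 0 := by
        rw [Ne, Complex.cpow_eq_zero_iff]; exact fun h => hne r h.1
      have hgeo := (hasSum_geometric_of_norm_lt_one
        ((hnorm r hr).trans_lt (by norm_num))).mul_left (w * (Complex.exp (hankelRay φ c r) *
          hankelRay φ c r ^ ((-1 : ℝ) : ℂ)))
      have hval : hankelRay φ c r ^ ((β - 1 : ℝ) : ℂ) * (hankelRay φ c r ^ (β : ℂ) - T)⁻¹ =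
          hankelRay φ c r ^ ((-1 : ℝ) : ℂ) * (1 - T * (hankelRay φ c r ^ (β : ℂ))⁻¹)⁻¹ := by
        have e1 : hankelRay φ c r ^ ((β - 1 : ℝ) : ℂ) =
            hankelRay φ c r ^ ((-1 : ℝ) : ℂ) * hankelRay φ c r ^ (β : ℂ) := by
          rw [← Complex.cpow_add _ _ (hne r)]; congr 1; push_cast; ring
        have e2 : 1 - T * (hankelRay φ c r ^ (β : ℂ))⁻¹ =
            (hankelRay φ c r ^ (β : ℂ) - T) / hankelRay φ c r ^ (β : ℂ) := by
          field_simp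
        rw [e1, e2, inv_div]; ring
      rw [hval, ← mul_assoc (Complex.exp (hankelRay φ c r)), ← mul_assoc w]
      refine hgeo.congr_fun fun k => ?_
      rw [hpow, mul_pow]; push_cast; ring
  refine ⟨?_, ?_, ?_⟩
  · refine IntegrableOn.congr_fun ?_ (fun s hs => (hrep s hs).symm) measurableSet_Ioi
    exact hKint.integral_prod_left.im.const_mul _
  · rw [setIntegral_congr_fun measurableSet_Ioi hrep, integral_const_mul]
    have h1 : ∫ s in Ioi (0 : ℝ), (∫ r in Ioi (0 : ℝ), K s r).im =
        (∫ s in Ioi (0 : ℝ), ∫ r in Ioi (0 : ℝ), K s r).im :=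
      integral_im hKint.integral_prod_left
    rw [h1, integral_integral_swap hKint, setIntegral_congr_fun measurableSet_Ioi hKs,
      integral_const_mul, Complex.im_ofReal_mul, mittagLeffler, hML.tsum_eq]
    field_simp
  · refine tsum_congr fun n => ?_
    rw [hT, ← Real.rpow_mul_natCast ht.le, mul_comm (n : ℝ) β]
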